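/- For every integer m ≥ 3 there exists δ_m > 0 such that for all n ≥ 1: r_3(ℤ_m^n) ≤ (m − δ_m)^n. -/

import Mathlib

/-- `S ⊆ (ℤ/mℤ)^n` contains no proper `k`-term arithmetic progression. -/
def ProgFree (m k : ℕ) {n : ℕ} (S : Finset (Fin n → ZMod m)) : Prop :=
  ¬ ∃ x d : Fin n → ZMod m,
      (Function.Injective fun i : Fin k => x + (i : ℕ) • d) ∧
      ∀ i : Fin k, x + (i : ℕ) • d ∈ S

/-- Maximal size of a subset of `(ℤ/mℤ)^n` without a proper `k`-term AP. -/
noncomputable def rAP (k m n : ℕ) : ℕ :=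
  sSup {c : ℕ | ∃ S : Finset (Fin n → ZMod m), ProgFree m k S ∧ S.card = c}


namespace CapSet

open Finset

/-- no nontrivial solution of `x + z = 2y`. -/
def APF {ι G : Type} [AddCommGroup G] (A : Finset (ι → G)) : Prop :=
  ∀ x ∈ A, ∀ y ∈ A, ∀ z ∈ A, x + z = y + y → x = z

section poly

variable (p : ℕ) [Fact p.Prime] (ι : Type) [Fintype ι] [DecidableEq ι]

/-- exponents -/
def expo : Finset (ι → ℕ) := Fintype.piFinset (fun _ => range p)

/-- low exponents -/
def low : Finset (ι → ℕ) := (expo p ι).filter (fun e => 3 * ∑ i, e i ≤ (p - 1) * Fintype.card ι)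

/-- medium exponents -/
def med : Finset (ι → ℕ) := (expo p ι).filter (fun e => 3 * ∑ i, e i ≤ 2 * ((p - 1) * Fintype.card ι))

/-- high exponents -/
def high : Finset (ι → ℕ) := (expo p ι).filter (fun e => ¬ 3 * ∑ i, e i ≤ 2 * ((p - 1) * Fintype.card ι))

variable {ι}

/-- monomial function -/
def mono (e : ι → ℕ) (a : ι → ZMod p) : ZMod p := ∏ i, a i ^ e i

variable (ι)

/-- span of a set of monomials -/
def Sp (E : Finset (ι → ℕ)) : Submodule (ZMod p) ((ι → ZMod p) → ZMod p) :=
  Submodule.span (ZMod p) (mono p '' (E : Set (ι → ℕ)))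

lemma finrank_Sp_le (E : Finset (ι → ℕ)) : Module.finrank (ZMod p) (Sp p ι E) ≤ E.card := by
  classical
  have : Sp p ι E = Submodule.span (ZMod p) ((E.image (mono p) : Finset _) : Set _) := by
    simp [Sp]
  rw [this]
  exact (finrank_span_finset_le_card _).trans card_image_le

lemma high_le_low : (high p ι).card ≤ (low p ι).card := by
  have hp := (Fact.out : p.Prime).two_le
  refine card_le_card_of_injOn (fun e i => p - 1 - e i) ?_ ?_
  · intro e he
    simp only [high, low, expo, coe_filter, Fintype.mem_piFinset, mem_range, Set.mem_ofPred_eq] at he ⊢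
    obtain ⟨h1, h2⟩ := he
    refine ⟨fun i => by omega, ?_⟩
    have : ∑ i, (p - 1 - e i) + ∑ i, e i = (p - 1) * Fintype.card ι := by
      rw [← sum_add_distrib, sum_congr rfl (g := fun _ => p - 1)]
      · simp [mul_comm]
      · intro i _
        have := h1 i
        omega
    omega
  · intro e he f hf h
    simp only [high, expo, coe_filter, Fintype.mem_piFinset, mem_range, Set.mem_ofPred_eq] at he hf
    funext i
    have h1 := he.1 i
    have h2 := hf.1 i
    have h3 := congrFun h i
    simp only at h3
    omega

lemma single_poly (φ : ZMod p → ZMod p) : ∃ c : ℕ → ZMod p, ∀ t, φ t = ∑ j ∈ range p, c j * t ^ j := by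
  classical
  refine ⟨fun j => (Lagrange.interpolate univ id φ).coeff j, fun t => ?_⟩
  have h1 := Lagrange.eval_interpolate_at_node (s := univ) (v := id) (i := t) φ
    (Function.injective_id.injOn) (mem_univ _)
  have h2 := Lagrange.degree_interpolate_lt (s := univ) (v := id) φ (Function.injective_id.injOn)
  rw [card_univ, ZMod.card] at h2
  have h3 : (Lagrange.interpolate univ id φ).natDegree < p := by
    by_cases h0 : Lagrange.interpolate univ id φ = 0
    · rw [h0]; simpa using (Fact.out : p.Prime).pos
    · exact (Polynomial.natDegree_lt_iff_degree_lt h0).2 h2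
  rw [← Polynomial.eval_eq_sum_range' h3]
  exact h1.symm

lemma span_top : Sp p ι (expo p ι) = ⊤ := by
  classical
  rw [eq_top_iff]
  intro f _
  have hf : f = ∑ a, f a • (fun x : ι → ZMod p => ∏ i, (if x i = a i then (1 : ZMod p) else 0)) := by
    funext x
    simp only [Finset.sum_apply, Pi.smul_apply, smul_eq_mul]
    rw [sum_eq_single x]
    · simp
    · intro b _ hb
      obtain ⟨i, hi⟩ := Function.ne_iff.1 hb
      rw [prod_eq_zero (mem_univ i), mul_zero]
      rw [if_neg (fun h => hi h.symm)]
    · simp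
  rw [hf]
  refine Submodule.sum_mem _ fun a _ => Submodule.smul_mem _ _ ?_
  choose c hc using fun i => single_poly p (fun t => if t = a i then (1 : ZMod p) else 0)
  have : (fun x : ι → ZMod p => ∏ i, (if x i = a i then (1 : ZMod p) else 0)) =
      ∑ e ∈ expo p ι, (∏ i, c i (e i)) • mono p e := by
    funext x
    simp only [Finset.sum_apply, Pi.smul_apply, smul_eq_mul, mono, expo]
    rw [prod_congr rfl (fun i _ => hc i (x i)), prod_univ_sum]
    simp [prod_mul_distrib]
  rw [this]
  refine Submodule.sum_mem _ fun e he => Submodule.smul_mem _ _ (Submodule.subset_span ⟨e, he, rfl⟩)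

lemma med_sup_high : Sp p ι (med p ι) ⊔ Sp p ι (high p ι) = ⊤ := by
  rw [← span_top p ι]
  unfold Sp
  rw [← Submodule.span_union, ← Set.image_union, ← coe_union]
  unfold med high
  rw [filter_union_filter_not_eq]

/-- functions vanishing off B -/
def Supp (B : Finset (ι → ZMod p)) : Submodule (ZMod p) ((ι → ZMod p) → ZMod p) :=
  LinearMap.ker (LinearMap.funLeft (ZMod p) (ZMod p) (Subtype.val : {v // v ∉ B} → (ι → ZMod p)))

lemma mem_Supp (B : Finset (ι → ZMod p)) (P) : P ∈ Supp p ι B ↔ ∀ v, v ∉ B → P v = 0 := by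
  simp only [Supp, LinearMap.mem_ker, funext_iff, LinearMap.funLeft_apply, Pi.zero_apply, Subtype.forall]

lemma dim_lower (B : Finset (ι → ZMod p)) :
    B.card ≤ Module.finrank (ZMod p) ↥(Supp p ι B ⊓ Sp p ι (med p ι)) + (high p ι).card := by
  classical
  have h1 := Submodule.finrank_sup_add_finrank_inf_eq (Supp p ι B) (Sp p ι (med p ι))
  have h2 := Submodule.finrank_add_le_finrank_add_finrank (Sp p ι (med p ι)) (Sp p ι (high p ι))
  rw [med_sup_high, finrank_top] at h2
  have h3 := finrank_Sp_le p ι (high p ι)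
  have h4 := Submodule.finrank_le (Supp p ι B ⊔ Sp p ι (med p ι))
  have h5 := LinearMap.finrank_range_add_finrank_ker
    (LinearMap.funLeft (ZMod p) (ZMod p) (Subtype.val : {v // v ∉ B} → (ι → ZMod p)))
  have h6 := Submodule.finrank_le (LinearMap.range
    (LinearMap.funLeft (ZMod p) (ZMod p) (Subtype.val : {v // v ∉ B} → (ι → ZMod p))))
  have h7 : Fintype.card {v // v ∉ B} + B.card = Fintype.card (ι → ZMod p) := by
    rw [Fintype.card_subtype_compl]
    have := card_le_univ B
    simp only [Fintype.card_coe]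
    omega
  change _ + Module.finrank (ZMod p) (Supp p ι B) = _ at h5
  rw [Module.finrank_fintype_fun_eq_card] at *
  omega

lemma exists_big_support (W : Submodule (ZMod p) ((ι → ZMod p) → ZMod p)) :
    ∃ P ∈ W, Module.finrank (ZMod p) W ≤ (univ.filter (fun v => P v ≠ 0)).card := by
  classical
  obtain ⟨P, hP⟩ := Finite.exists_max (fun P : W => (univ.filter (fun v => P.1 v ≠ 0)).card)
  refine ⟨P, P.2, ?_⟩
  by_contra! hlt
  let T : W →ₗ[ZMod p] ({v // P.1 v ≠ 0} → ZMod p) :=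
    (LinearMap.funLeft (ZMod p) (ZMod p) (Subtype.val)).comp W.subtype
  have hk : LinearMap.ker T ≠ ⊥ := by
    apply LinearMap.ker_ne_bot_of_finrank_lt
    rw [Module.finrank_fintype_fun_eq_card, Fintype.card_subtype]
    exact hlt
  obtain ⟨Q, hQ, hQ0⟩ := Submodule.exists_mem_ne_zero_of_ne_bot hk
  have hQ1 : ∀ v, P.1 v ≠ 0 → Q.1 v = 0 := by
    intro v hv
    exact congrFun (LinearMap.mem_ker.1 hQ) ⟨v, hv⟩
  have : ∃ v, Q.1 v ≠ 0 := by
    by_contra! h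
    exact hQ0 (Subtype.ext (funext h))
  obtain ⟨v, hv⟩ := this
  have hlt2 : (univ.filter (fun v => P.1 v ≠ 0)).card < (univ.filter (fun v => (P + Q).1 v ≠ 0)).card := by
    apply card_lt_card
    rw [ssubset_iff_of_subset]
    · refine ⟨v, ?_, ?_⟩
      · have : P.1 v = 0 := by
          by_contra h
          exact hv (hQ1 v h)
        simp [this, hv]
      · simp only [mem_filter, mem_univ, true_and, not_not]
        by_contra h
        exact hv (hQ1 v h)
    · intro w hw
      simp only [mem_filter, mem_univ, true_and] at hw ⊢
      simpa [hQ1 w hw] using hw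
  exact absurd (hP (P + Q)) (not_le.2 hlt2)

/-- low rank kernels -/
def LR (K : (ι → ZMod p) → (ι → ZMod p) → ZMod p) : Prop :=
  ∃ g h : (ι → ℕ) → (ι → ZMod p) → ZMod p, ∀ a b,
    K a b = ∑ e ∈ low p ι, mono p e a * g e b + ∑ e ∈ low p ι, h e a * mono p e b

variable {ι}

lemma LR_zero : LR p ι (fun _ _ => 0) := ⟨fun _ _ => 0, fun _ _ => 0, by simp⟩

lemma LR_add {K L} (hK : LR p ι K) (hL : LR p ι L) : LR p ι (fun a b => K a b + L a b) := by
  obtain ⟨g, h, H⟩ := hK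
  obtain ⟨g', h', H'⟩ := hL
  refine ⟨fun e b => g e b + g' e b, fun e b => h e b + h' e b, fun a b => ?_⟩
  simp only [H, H', mul_add, add_mul, sum_add_distrib]
  ring

lemma LR_smul {K} (c : ZMod p) (hK : LR p ι K) : LR p ι (fun a b => c * K a b) := by
  obtain ⟨g, h, H⟩ := hK
  refine ⟨fun e b => c * g e b, fun e b => c * h e b, fun a b => ?_⟩
  simp only [H]
  rw [mul_add, mul_sum, mul_sum]
  congr 1 <;> exact sum_congr rfl fun _ _ => by ring

lemma LR_sum {α : Type} (s : Finset α) (K : α → (ι → ZMod p) → (ι → ZMod p) → ZMod p)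
    (h : ∀ j ∈ s, LR p ι (K j)) : LR p ι (fun a b => ∑ j ∈ s, K j a b) := by
  classical
  induction s using Finset.induction_on with
  | empty => simpa using LR_zero p
  | insert j s hj ih =>
    simp only [sum_insert hj]
    exact LR_add p (h j (mem_insert_self _ _)) (ih fun i hi => h i (mem_insert_of_mem hi))

lemma LR_left (e f : ι → ℕ) (he : e ∈ low p ι) : LR p ι (fun a b => mono p e a * mono p f b) := by
  classical
  refine ⟨fun e' b => if e' = e then mono p f b else 0, fun _ _ => 0, fun a b => ?_⟩
  simp [he]

lemma LR_right (e f : ι → ℕ) (hf : f ∈ low p ι) : LR p ι (fun a b => mono p e a * mono p f b) := by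
  classical
  refine ⟨fun _ _ => 0, fun e' b => if e' = f then mono p e b else 0, fun a b => ?_⟩
  simp [hf]

lemma LR_mono (e : ι → ℕ) (he : e ∈ med p ι) : LR p ι (fun a b => mono p e (a + b)) := by
  have : (fun a b : ι → ZMod p => mono p e (a + b)) = fun a b =>
      ∑ j ∈ Fintype.piFinset (fun i => range (e i + 1)),
        (∏ i, ((e i).choose (j i) : ZMod p)) * (mono p j a * mono p (fun i => e i - j i) b) := by
    funext a b
    simp only [mono, Pi.add_apply, add_pow]
    rw [prod_univ_sum]
    refine sum_congr rfl fun j _ => ?_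
    rw [← prod_mul_distrib, ← prod_mul_distrib]
    exact prod_congr rfl fun i _ => by ring
  rw [this]
  refine LR_sum p _ _ fun j hj => LR_smul p _ ?_
  simp only [Fintype.mem_piFinset, mem_range] at hj
  simp only [med, expo, mem_filter, Fintype.mem_piFinset, mem_range] at he
  obtain ⟨h1, h2⟩ := he
  have hs : ∑ i, j i + ∑ i, (e i - j i) = ∑ i, e i := by
    rw [← sum_add_distrib]
    refine sum_congr rfl fun i _ => ?_
    have := hj i
    omega
  by_cases hl : 3 * ∑ i, j i ≤ (p - 1) * Fintype.card ι
  · apply LR_left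
    simp only [low, expo, mem_filter, Fintype.mem_piFinset, mem_range]
    exact ⟨fun i => by have := hj i; have := h1 i; omega, hl⟩
  · apply LR_right
    simp only [low, expo, mem_filter, Fintype.mem_piFinset, mem_range]
    exact ⟨fun i => by have := hj i; have := h1 i; omega, by omega⟩

lemma LR_poly (P) (hP : P ∈ Sp p ι (med p ι)) : LR p ι (fun a b => P (a + b)) := by
  unfold Sp at hP
  induction hP using Submodule.span_induction with
  | mem x h => obtain ⟨e, he, rfl⟩ := h; exact LR_mono p e he
  | zero => exact LR_zero p
  | add x y _ _ hx hy => exact LR_add p hx hy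
  | smul c x _ hx => exact LR_smul p c hx

lemma rank_add_le' {X : Type} [Fintype X] [DecidableEq X] (M N : Matrix X X (ZMod p)) :
    (M + N).rank ≤ M.rank + N.rank := by
  unfold Matrix.rank
  rw [Matrix.mulVecLin_add]
  refine le_trans (Submodule.finrank_mono ?_) (Submodule.finrank_add_le_finrank_add_finrank _ _)
  rintro _ ⟨x, rfl⟩
  exact Submodule.add_mem_sup ⟨x, rfl⟩ ⟨x, rfl⟩

lemma rank_bound {X : Type} [Fintype X] [DecidableEq X] (P) (hP : P ∈ Sp p ι (med p ι))
    (f g : X → ι → ZMod p) (D : X → ZMod p) (hD : ∀ x, P (f x + g x) = D x)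
    (hoff : ∀ x y, x ≠ y → P (f x + g y) = 0) :
    (univ.filter (fun x => D x ≠ 0)).card ≤ 2 * (low p ι).card := by
  classical
  obtain ⟨u, v, H⟩ := LR_poly p P hP
  have hM : Matrix.diagonal D =
      (Matrix.of fun (x : X) (e : low p ι) => mono p e.1 (f x)) *
        (Matrix.of fun (e : low p ι) (y : X) => u e.1 (g y)) +
      (Matrix.of fun (x : X) (e : low p ι) => v e.1 (f x)) *
        (Matrix.of fun (e : low p ι) (y : X) => mono p e.1 (g y)) := by
    ext x y
    simp only [Matrix.add_apply, Matrix.mul_apply, Matrix.of_apply]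
    rw [sum_coe_sort (low p ι) (fun e => mono p e (f x) * u e (g y)),
      sum_coe_sort (low p ι) (fun e => v e (f x) * mono p e (g y)), ← H]
    by_cases hxy : x = y
    · subst hxy; simp [hD]
    · simp [hxy, hoff x y hxy]
  have h1 := Matrix.rank_diagonal D
  have h2 := hM ▸ rank_add_le' p
      ((Matrix.of fun (x : X) (e : low p ι) => mono p e.1 (f x)) *
        (Matrix.of fun (e : low p ι) (y : X) => u e.1 (g y)))
      ((Matrix.of fun (x : X) (e : low p ι) => v e.1 (f x)) *
        (Matrix.of fun (e : low p ι) (y : X) => mono p e.1 (g y)))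
  have h3 := (Matrix.rank_mul_le_left (Matrix.of fun (x : X) (e : low p ι) => mono p e.1 (f x))
        (Matrix.of fun (e : low p ι) (y : X) => u e.1 (g y))).trans (Matrix.rank_le_card_width _)
  have h4 := (Matrix.rank_mul_le_left (Matrix.of fun (x : X) (e : low p ι) => v e.1 (f x))
        (Matrix.of fun (e : low p ι) (y : X) => mono p e.1 (g y))).trans (Matrix.rank_le_card_width _)
  rw [Fintype.card_coe] at h3 h4
  rw [Fintype.card_subtype] at h1
  omega

lemma bound_odd (hp : p ≠ 2) (A : Finset (ι → ZMod p)) (hA : APF A) :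
    A.card ≤ 3 * (low p ι).card := by
  classical
  have h2 : (2 : ZMod p) ≠ 0 := by
    intro h
    have : ((2 : ℕ) : ZMod p) = 0 := by exact_mod_cast h
    rw [ZMod.natCast_eq_zero_iff] at this
    exact hp ((Nat.prime_dvd_prime_iff_eq Fact.out Nat.prime_two).1 this)
  have hinj : Function.Injective (fun a : ι → ZMod p => a + a) := by
    intro a b h
    funext i
    have := congrFun h i
    simp only [Pi.add_apply, ← two_mul] at this
    exact mul_left_cancel₀ h2 this
  set B := A.image (fun a => a + a) with hB
  have hBc : B.card = A.card := card_image_of_injective _ hinj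
  have hd := dim_lower p ι B
  obtain ⟨P, hP, hPc⟩ := exists_big_support p ι (Supp p ι B ⊓ Sp p ι (med p ι))
  obtain ⟨hP1, hP2⟩ := Submodule.mem_inf.1 hP
  rw [mem_Supp] at hP1
  have hr := rank_bound p P hP2 (fun x : A => x.1) (fun x : A => x.1) (fun x => P (x.1 + x.1))
    (fun x => rfl) (by
      intro x y hxy
      apply hP1
      intro hm
      obtain ⟨c, hc, hcc⟩ := mem_image.1 hm
      exact hxy (Subtype.ext (hA x.1 x.2 c hc y.1 y.2 hcc.symm)))
  have hc : (univ.filter (fun v => P v ≠ 0)).card ≤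
      (univ.filter (fun x : A => P (x.1 + x.1) ≠ 0)).card := by
    refine card_le_card_of_surjOn (fun x : A => x.1 + x.1) ?_
    intro v hv
    simp only [coe_filter, mem_univ, true_and, Set.mem_ofPred_eq] at hv
    have : v ∈ B := by
      by_contra h
      exact hv (hP1 v h)
    obtain ⟨c, hc, rfl⟩ := mem_image.1 this
    exact ⟨⟨c, hc⟩, by simpa using hv, rfl⟩
  have := high_le_low p ι
  omega

end poly

/-- first digit -/
def dg (x : ZMod 4) : ZMod 2 := (x.val : ZMod 2)
/-- second digit -/
def dh (x : ZMod 4) : ZMod 2 := ((x.val / 2 : ℕ) : ZMod 2)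

lemma dig : ∀ x y z : ZMod 4, dg x = dg z → dh x + (dh z + dg x) = dg y → x + z = y + y := by
  decide

lemma dig_inj : ∀ x y : ZMod 4, dg x = dg y → dh x = dh y → x = y := by decide

instance : Fact (Nat.Prime 2) := ⟨Nat.prime_two⟩

lemma arith_four (a U L N : ℕ) (h1 : a ≤ U * N + N * (2 * L)) (h2 : U ≤ L) : a ≤ N * (3 * L) := by
  nlinarith [Nat.mul_le_mul_right N h2]

/-- fibre -/
def Fib {ι : Type} [Fintype ι] (A : Finset (ι → ZMod 4)) (u : ι → ZMod 2) : Finset (ι → ZMod 4) :=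
  A.filter (fun x => (fun i => dg (x i)) = u)

/-- large fibres -/
def Large {ι : Type} [Fintype ι] [DecidableEq ι] (A : Finset (ι → ZMod 4)) : Finset (ι → ZMod 2) :=
  univ.filter (fun u => 2 * (low 2 ι).card < (Fib A u).card)

lemma four_large {ι : Type} [Fintype ι] [DecidableEq ι] (A : Finset (ι → ZMod 4)) (hA : APF A) :
    (Large A).card ≤ (high 2 ι).card := by
  set U := Large A with hU
  have hd := dim_lower 2 ι U
  suffices h : Supp 2 ι U ⊓ Sp 2 ι (med 2 ι) = ⊥ by
    rw [h, finrank_bot] at hd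
    omega
  rw [eq_bot_iff]
  intro P hP
  obtain ⟨hP1, hP2⟩ := Submodule.mem_inf.1 hP
  rw [mem_Supp] at hP1
  rw [Submodule.mem_bot]
  funext u
  by_cases hu : u ∈ U
  · by_contra hPu
    have hr := rank_bound 2 P hP2 (fun (x : Fib A u) i => dh (x.1 i)) (fun (x : Fib A u) i => dh (x.1 i) + u i)
      (fun _ => P u) (by
        intro x
        congr 1
        funext i
        simp only [Pi.add_apply]
        rw [← add_assoc, CharTwo.add_self_eq_zero, zero_add]) (by
        intro x y hxy
        apply hP1
        intro hm
        have hpos := (mem_filter.1 hm).2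
        obtain ⟨c, hc⟩ := card_pos.1 (lt_of_le_of_lt (Nat.zero_le _) hpos)
        obtain ⟨hc1, hc2⟩ := mem_filter.1 hc
        obtain ⟨hx1, hx2⟩ := mem_filter.1 x.2
        obtain ⟨hy1, hy2⟩ := mem_filter.1 y.2
        refine hxy (Subtype.ext (hA x.1 hx1 c hc1 y.1 hy1 ?_))
        funext i
        refine dig _ _ _ ((congrFun hx2 i).trans (congrFun hy2 i).symm) ?_
        have e1 := congrFun hx2 i
        have e2 := congrFun hc2 i
        simp only [Pi.add_apply] at e1 e2
        rw [e1, e2])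
    have hPu' : P u ≠ 0 := hPu
    simp only [ne_eq, hPu', not_false_eq_true, filter_true, card_univ, Fintype.card_coe] at hr
    have := (mem_filter.1 hu).2
    omega
  · exact hP1 u hu
lemma card_two (ι : Type) [Fintype ι] [DecidableEq ι] : Fintype.card (ι → ZMod 2) = 2 ^ Fintype.card ι := by
  rw [Fintype.card_fun, ZMod.card]

lemma Fib_le {ι : Type} [Fintype ι] [DecidableEq ι] (A : Finset (ι → ZMod 4)) (u : ι → ZMod 2) :
    (Fib A u).card ≤ 2 ^ Fintype.card ι := by
  rw [← card_two, ← card_univ]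
  refine card_le_card_of_injOn (fun x i => dh (x i)) (fun _ _ => mem_coe.2 (mem_univ _)) ?_
  intro x hx y hy hxy
  have hx := (mem_filter.1 (mem_coe.1 hx)).2
  have hy := (mem_filter.1 (mem_coe.1 hy)).2
  funext i
  exact dig_inj _ _ ((congrFun hx i).trans (congrFun hy i).symm) (congrFun hxy i)

lemma Fib_sum {ι : Type} [Fintype ι] [DecidableEq ι] (A : Finset (ι → ZMod 4)) :
    A.card = ∑ u, (Fib A u).card := by
  classical
  rw [card_eq_sum_card_fiberwise (s := A) (t := (univ : Finset (ι → ZMod 2))) (f := fun x i => dg (x i))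
    (fun _ _ => mem_coe.2 (mem_univ _))]
  refine sum_congr rfl fun u _ => congrArg card ?_
  ext x
  rw [Fib, mem_filter]

lemma Fib_le' {ι : Type} [Fintype ι] [DecidableEq ι] (A : Finset (ι → ZMod 4)) (u : ι → ZMod 2) :
    (Fib A u).card ≤ (if u ∈ Large A then 2 ^ Fintype.card ι else 0) + 2 * (low 2 ι).card := by
  split_ifs with h
  · exact (Fib_le A u).trans (Nat.le_add_right _ _)
  · simp only [Large, mem_filter, mem_univ, true_and, not_lt] at h
    omega

lemma sum_aux {α : Type} [Fintype α] [DecidableEq α] (U : Finset α) (N L : ℕ) :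
    ∑ u : α, ((if u ∈ U then N else 0) + L) = U.card * N + Fintype.card α * L := by
  rw [sum_add_distrib, sum_ite_mem, univ_inter, sum_const, sum_const, card_univ, smul_eq_mul, smul_eq_mul]

lemma bound_four {ι : Type} [Fintype ι] [DecidableEq ι] (A : Finset (ι → ZMod 4)) (hA : APF A) :
    A.card ≤ 2 ^ Fintype.card ι * (3 * (low 2 ι).card) := by
  have h1 := (Fib_sum A).le.trans (sum_le_sum fun u _ => Fib_le' A u)
  rw [sum_aux, card_two] at h1
  exact arith_four _ _ _ _ h1 ((four_large A hA).trans (high_le_low 2 ι))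

lemma exists_y (p : ℕ) (hp : 2 ≤ p) : ∃ y : ℝ, 0 < y ∧ y < 1 ∧ ∑ i ∈ range p, y ^ (3 * i) < p * y ^ (p - 1) := by
  have hd : HasDerivAt (fun y : ℝ => ∑ i ∈ range p, y ^ (3 * i) - p * y ^ (p - 1))
      (∑ i ∈ range p, ((3 * i : ℕ) : ℝ) * 1 ^ (3 * i - 1) - p * (((p - 1 : ℕ) : ℝ) * 1 ^ (p - 1 - 1))) 1 := by
    refine HasDerivAt.sub ?_ ?_
    · exact HasDerivAt.fun_sum fun i _ => hasDerivAt_pow _ _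
    · exact (hasDerivAt_pow _ _).const_mul _
  have hpos : 0 < ∑ i ∈ range p, ((3 * i : ℕ) : ℝ) * 1 ^ (3 * i - 1) - p * (((p - 1 : ℕ) : ℝ) * 1 ^ (p - 1 - 1)) := by
    have h1 : ((∑ i ∈ range p, i : ℕ) : ℝ) * 2 = p * ((p - 1 : ℕ) : ℝ) := by
      exact_mod_cast sum_range_id_mul_two p
    have h2 : ∑ i ∈ range p, ((3 * i : ℕ) : ℝ) * 1 ^ (3 * i - 1) = 3 * ((∑ i ∈ range p, i : ℕ) : ℝ) := by
      simp [mul_sum]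
    have h3 : (0 : ℝ) < p := by positivity
    have h4 : (0 : ℝ) < ((p - 1 : ℕ) : ℝ) := by
      have : 0 < p - 1 := by omega
      exact_mod_cast this
    have := mul_pos h3 h4
    rw [h2, one_pow]
    linarith
  have hs := hd.tendsto_slope
  have hev := (hs.eventually (lt_mem_nhds hpos))
  have hev2 := hev.filter_mono (nhdsWithin_mono 1 (fun y (hy : y ∈ Set.Iio (1 : ℝ)) => ne_of_lt hy))
  have hev3 : ∀ᶠ y in nhdsWithin (1 : ℝ) (Set.Iio 1), 0 < y :=
    Filter.Eventually.filter_mono nhdsWithin_le_nhds (lt_mem_nhds one_pos)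
  obtain ⟨y, ⟨hy1, hy2⟩, hy3⟩ := ((hev2.and hev3).and self_mem_nhdsWithin).exists
  have hy3 : y < 1 := hy3
  refine ⟨y, hy2, hy3, ?_⟩
  rw [slope_def_field] at hy1
  simp only [one_pow, sum_const, card_range, nsmul_eq_mul, mul_one, sub_self, sub_zero] at hy1
  have hneg : y - 1 < 0 := by linarith
  by_contra! h
  exact absurd hy1 (not_lt.2 (div_nonpos_of_nonneg_of_nonpos (by linarith) hneg.le))

lemma low_bound (p : ℕ) (hp : 2 ≤ p) : ∃ c : ℝ, 0 < c ∧ c < p ∧ ∀ (ι : Type) [Fintype ι] [DecidableEq ι],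
    ((low p ι).card : ℝ) ≤ c ^ Fintype.card ι := by
  obtain ⟨y, h0, h1, hy⟩ := exists_y p hp
  refine ⟨(∑ i ∈ range p, y ^ (3 * i)) / y ^ (p - 1), ?_, ?_, ?_⟩
  · have : (range p).Nonempty := ⟨0, by simp; omega⟩
    positivity
  · rw [div_lt_iff₀ (by positivity)]
    exact hy
  · intro ι _ _
    rw [div_pow, le_div_iff₀ (by positivity)]
    have e1 : (∑ i ∈ range p, y ^ (3 * i)) ^ Fintype.card ι = ∑ e ∈ expo p ι, y ^ (3 * ∑ i, e i) := by
      rw [← card_univ, ← prod_const, prod_univ_sum]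
      refine sum_congr rfl fun e _ => ?_
      rw [prod_pow_eq_pow_sum, mul_sum]
    rw [e1, ← pow_mul]
    calc ((low p ι).card : ℝ) * y ^ ((p - 1) * Fintype.card ι)
        = ∑ e ∈ low p ι, y ^ ((p - 1) * Fintype.card ι) := by simp
      _ ≤ ∑ e ∈ low p ι, y ^ (3 * ∑ i, e i) := by
        refine sum_le_sum fun e he => ?_
        exact pow_le_pow_of_le_one h0.le h1.le (mem_filter.1 he).2
      _ ≤ _ := sum_le_sum_of_subset_of_nonneg (filter_subset _ _) fun _ _ _ => by positivity

/-- a modulus with an exponential saving. -/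
def Good (M : ℕ) : Prop := ∃ c : ℝ, 0 < c ∧ c < M ∧ ∀ (ι : Type) [Fintype ι] [DecidableEq ι]
  (A : Finset (ι → ZMod M)), APF A → (A.card : ℝ) ≤ 3 * c ^ Fintype.card ι

lemma good_odd (p : ℕ) (hp : p.Prime) (h2 : p ≠ 2) : Good p := by
  have : Fact p.Prime := ⟨hp⟩
  obtain ⟨c, h0, h1, h⟩ := low_bound p hp.two_le
  refine ⟨c, h0, h1, fun ι _ _ A hA => ?_⟩
  have := bound_odd p h2 A hA
  have h3 : (A.card : ℝ) ≤ 3 * (low p ι).card := by exact_mod_cast this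
  linarith [h ι]

lemma good_four : Good 4 := by
  obtain ⟨c, h0, h1, h⟩ := low_bound 2 le_rfl
  refine ⟨2 * c, by positivity, by push_cast at h1 ⊢; linarith, fun ι _ _ A hA => ?_⟩
  have := bound_four A hA
  have h3 : (A.card : ℝ) ≤ 2 ^ Fintype.card ι * (3 * (low 2 ι).card) := by exact_mod_cast this
  have h4 := mul_le_mul_of_nonneg_left (h ι) (by positivity : (0 : ℝ) ≤ 2 ^ Fintype.card ι)
  rw [mul_pow]
  linarith

lemma good_mul (k M : ℕ) (hk : 0 < k) (hM : 0 < M) (h : Good M) : Good (k * M) := by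
  obtain ⟨c, h0, h1, h⟩ := h
  have hkR : (0 : ℝ) < k := by exact_mod_cast hk
  refine ⟨k * c, by positivity, by push_cast; exact mul_lt_mul_of_pos_left h1 hkR, fun ι _ _ A hA => ?_⟩
  classical
  have : NeZero (k * M) := ⟨by positivity⟩
  let q : (ι → ZMod (k * M)) → (ι → Fin k) := fun x i => ⟨(x i).val % k, Nat.mod_lt _ hk⟩
  let t : (ι → ZMod (k * M)) → (ι → ZMod M) := fun x i => (((x i).val / k : ℕ) : ZMod M)
  have hsum : A.card = ∑ u, (A.filter (fun x => q x = u)).card :=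
    card_eq_sum_card_fiberwise (f := q) (fun _ _ => mem_coe.2 (mem_univ _))
  have key : ∀ u x y z, q x = u → q y = u → q z = u → t x + t z = t y + t y → x + z = y + y := by
    intro u x y z hx hy hz ht
    funext i
    have e1 : (x i).val % k = (u i).1 := congrArg Fin.val (congrFun hx i)
    have e2 : (y i).val % k = (u i).1 := congrArg Fin.val (congrFun hy i)
    have e3 : (z i).val % k = (u i).1 := congrArg Fin.val (congrFun hz i)
    have e4 := congrFun ht i
    simp only [Pi.add_apply, t] at e4
    rw [← Nat.cast_add, ← Nat.cast_add, ZMod.natCast_eq_natCast_iff] at e4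
    have e5 := Nat.ModEq.add_left (2 * (u i).1) (Nat.ModEq.mul_left' k e4)
    have f1 := Nat.mod_add_div (x i).val k
    have f2 := Nat.mod_add_div (y i).val k
    have f3 := Nat.mod_add_div (z i).val k
    have g1 : 2 * (u i).1 + k * ((x i).val / k + (z i).val / k) = (x i).val + (z i).val := by
      rw [mul_add]; omega
    have g2 : 2 * (u i).1 + k * ((y i).val / k + (y i).val / k) = (y i).val + (y i).val := by
      rw [mul_add]; omega
    rw [g1, g2, ← ZMod.natCast_eq_natCast_iff] at e5
    simpa using e5
  have hinj : ∀ u x y, q x = u → q y = u → t x = t y → x = y := by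
    intro u x y hx hy ht
    have e := key u x y y hx hy hy (by rw [ht])
    exact add_right_cancel e
  have hF : ∀ u, ((A.filter (fun x => q x = u)).card : ℝ) ≤ 3 * c ^ Fintype.card ι := by
    intro u
    have hc : ((A.filter (fun x => q x = u)).image t).card = (A.filter (fun x => q x = u)).card := by
      apply card_image_of_injOn
      intro x hx y hy hxy
      exact hinj u x y (mem_filter.1 hx).2 (mem_filter.1 hy).2 hxy
    rw [← hc]
    apply h
    intro x hx y hy z hz hxyz
    obtain ⟨x, hx', rfl⟩ := mem_image.1 hx
    obtain ⟨y, hy', rfl⟩ := mem_image.1 hy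
    obtain ⟨z, hz', rfl⟩ := mem_image.1 hz
    obtain ⟨hx1, hx2⟩ := mem_filter.1 hx'
    obtain ⟨hy1, hy2⟩ := mem_filter.1 hy'
    obtain ⟨hz1, hz2⟩ := mem_filter.1 hz'
    rw [hA x hx1 y hy1 z hz1 (key u x y z hx2 hy2 hz2 hxyz)]
  rw [hsum]
  push_cast
  refine (sum_le_sum fun u _ => hF u).trans ?_
  rw [sum_const, card_univ, Fintype.card_fun, Fintype.card_fin, nsmul_eq_mul, mul_pow]
  push_cast
  exact le_of_eq (by ring)

lemma good_all (m : ℕ) (hm : 3 ≤ m) : Good m := by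
  by_cases h : ∃ p, p.Prime ∧ p ≠ 2 ∧ p ∣ m
  · obtain ⟨p, hp, h2, k, rfl⟩ := h
    rw [mul_comm]
    exact good_mul k p (by rcases Nat.eq_zero_or_pos k with rfl | h <;> omega) hp.pos (good_odd p hp h2)
  · push Not at h
    have hm2 : m = 2 ^ m.primeFactorsList.length :=
      Nat.eq_prime_pow_of_unique_prime_dvd (by omega) (fun {d} hd hdm => by
        by_contra h2
        exact h d hd h2 hdm)
    have hl : 2 ≤ m.primeFactorsList.length := by
      by_contra! hlt
      have : m.primeFactorsList.length = 0 ∨ m.primeFactorsList.length = 1 := by omega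
      rcases this with h | h <;> rw [h] at hm2 <;> omega
    obtain ⟨k, hk⟩ := Nat.exists_eq_add_of_le hl
    rw [hk, pow_add, mul_comm] at hm2
    rw [hm2]
    exact good_mul _ 4 (by positivity) (by norm_num) good_four

lemma power_trick (m : ℕ) (c : ℝ) (h0 : 0 < c) (h : ∀ (ι : Type) [Fintype ι] [DecidableEq ι]
    (A : Finset (ι → ZMod m)), APF A → (A.card : ℝ) ≤ 3 * c ^ Fintype.card ι)
    (n : ℕ) (A : Finset (Fin n → ZMod m)) (hA : APF A) : (A.card : ℝ) ≤ c ^ n := by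
  classical
  by_contra! hlt
  have hcn : 0 < c ^ n := by positivity
  obtain ⟨k, hk⟩ := pow_unbounded_of_one_lt 3 ((one_lt_div hcn).2 hlt)
  let B : Finset (Fin k × Fin n → ZMod m) :=
    (Fintype.piFinset (fun _ : Fin k => A)).image (fun f ij => f ij.1 ij.2)
  have hB : B.card = A.card ^ k := by
    rw [card_image_of_injective, Fintype.card_piFinset_const]
    · intro f g hfg
      funext i j
      exact congrFun hfg (i, j)
  have hAPF : APF B := by
    intro x hx y hy z hz hxyz
    obtain ⟨x, hx', rfl⟩ := mem_image.1 hx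
    obtain ⟨y, hy', rfl⟩ := mem_image.1 hy
    obtain ⟨z, hz', rfl⟩ := mem_image.1 hz
    rw [Fintype.mem_piFinset] at hx' hy' hz'
    have : x = z := by
      funext i
      refine hA _ (hx' i) _ (hy' i) _ (hz' i) ?_
      funext j
      exact congrFun hxyz (i, j)
    rw [this]
  have := h _ B hAPF
  rw [hB, Fintype.card_prod, Fintype.card_fin, Fintype.card_fin, mul_comm k n, pow_mul] at this
  rw [div_pow, lt_div_iff₀ (by positivity)] at hk
  push_cast at this
  linarith

lemma apf_of_progFree (m n : ℕ) (S : Finset (Fin n → ZMod m)) (h : ProgFree m 3 S) : APF S := by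
  intro x hx y hy z hz hxyz
  by_contra hne
  have hz' : z = x + 2 • (y - x) := by
    rw [two_nsmul]
    have : z = y + y - x := by rw [← hxyz]; abel
    rw [this]; abel
  have hy' : y = x + 1 • (y - x) := by simp
  have hx' : x = x + 0 • (y - x) := by simp
  have hxy : x ≠ y := by
    rintro rfl
    exact hne (add_left_cancel hxyz).symm
  have hyz : y ≠ z := by
    rintro rfl
    exact hne (add_right_cancel hxyz)
  refine h ⟨x, y - x, ?_, ?_⟩
  · intro i j hij
    fin_cases i <;> fin_cases j <;> simp only [] at hij ⊢ <;> exfalso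
    · exact hxy (by rw [hy']; simpa using hij)
    · exact hne (by rw [hz']; simpa using hij)
    · exact hxy (by rw [hy']; simpa using hij.symm)
    · refine hyz ?_
      rw [hz']; simpa using hij
    · exact hne (by rw [hz']; simpa using hij.symm)
    · refine hyz ?_
      rw [hz']; simpa using hij.symm
  · intro i
    fin_cases i
    · simpa using hx
    · simpa using hy
    · change x + 2 • (y - x) ∈ S
      rw [← hz']; exact hz

end CapSet

theorem stmt14 (m : ℕ) (hm : 3 ≤ m) :
    ∃ δ : ℝ, 0 < δ ∧ ∀ n : ℕ, 1 ≤ n →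
      (rAP 3 m n : ℝ) ≤ ((m : ℝ) - δ) ^ n := by
  obtain ⟨c, h0, h1, h⟩ := CapSet.good_all m hm
  have : NeZero m := ⟨by omega⟩
  refine ⟨m - c, by linarith, fun n _ => ?_⟩
  have hmem : rAP 3 m n ∈ {c : ℕ | ∃ S : Finset (Fin n → ZMod m), ProgFree m 3 S ∧ S.card = c} := by
    apply Nat.sSup_mem
    · refine ⟨0, ∅, ?_, by simp⟩
      rintro ⟨x, d, _, h⟩
      simpa using h 0
    · refine ⟨Fintype.card (Fin n → ZMod m), ?_⟩
      rintro c ⟨S, _, rfl⟩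
      exact Finset.card_le_univ S
  obtain ⟨S, hS, hc⟩ := hmem
  rw [← hc, sub_sub_cancel]
  exact CapSet.power_trick m c h0 h n S (CapSet.apf_of_progFree m n S hS)
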